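/- Let s, r be positive integers and x = s·log q / log(1 + 1/r), so that r = 1/(q^{s/x} − 1). A monic polynomial h ∈ 𝔽_q[t] satisfies τ(h)·q^{−deg h/x} ≥ τ(f)·q^{−deg f/x} for all monic f ∈ 𝔽_q[t] if and only if: for every monic irreducible p with deg p ≠ s the multiplicity of p in h equals ⌊1/(q^{deg p/x} − 1)⌋, and for every monic irreducible p with deg p = s the multiplicity of p in h is r or r − 1. Consequently there are exactly 2^{π(s)} such maximizers h, where π(s) is the number of monic irreducible polynomials of degree s in 𝔽_q[t]. -/

import Mathlib

open Polynomial

/-- The number of monic divisors of a polynomial. -/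
noncomputable def tau {Fq : Type} [Field Fq] (f : Fq[X]) : ℕ :=
  {d : Fq[X] | d.Monic ∧ d ∣ f}.ncard

/-- The multiplicity of `p` in the factorization of `f`. -/
noncomputable def mult {Fq : Type} [Field Fq] (p f : Fq[X]) : ℕ :=
  multiplicity p f

section Factorization

variable {Fq : Type} [Field Fq]

theorem eq_of_monic_irreducible_dvd {p q : Fq[X]} (hp : p.Monic) (hq : q.Monic)
    (hpi : Irreducible p) (hqi : Irreducible q) (h : p ∣ q) : p = q :=
  eq_of_monic_of_associated hp hq (hpi.associated_of_dvd hqi h)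

theorem exists_monic_irreducible_dvd {f : Fq[X]} (hf : f.Monic) (h1 : f ≠ 1) :
    ∃ p : Fq[X], p.Monic ∧ Irreducible p ∧ p ∣ f :=
  Polynomial.exists_monic_irreducible_factor f fun hu => h1 (hf.eq_one_of_isUnit hu)

theorem mult_eq_zero {p f : Fq[X]} (h : ¬ p ∣ f) : mult p f = 0 :=
  multiplicity_eq_zero.2 h

theorem finiteMultiplicity_of_irreducible {p f : Fq[X]} (hp : Irreducible p) (hf : f ≠ 0) :
    FiniteMultiplicity p f :=
  FiniteMultiplicity.of_not_isUnit hp.not_isUnit hf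

theorem exists_eq_pow_mult_mul {p f : Fq[X]} (hpm : p.Monic) (hp : Irreducible p)
    (hf : f.Monic) : ∃ g : Fq[X], g.Monic ∧ ¬ p ∣ g ∧ f = p ^ mult p f * g := by
  obtain ⟨g, hg, hn⟩ :=
    (finiteMultiplicity_of_irreducible hp hf.ne_zero).exists_eq_pow_mul_and_not_dvd
  refine ⟨g, ?_, hn, hg⟩
  refine (hpm.pow (multiplicity p f)).of_mul_monic_left ?_
  rw [← hg]
  exact hf

theorem mult_mul {p f g : Fq[X]} (hp : Irreducible p) (hf : f ≠ 0) (hg : g ≠ 0) :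
    mult p (f * g) = mult p f + mult p g :=
  multiplicity_mul hp.prime (finiteMultiplicity_of_irreducible hp (mul_ne_zero hf hg))

theorem mult_pow_self {p : Fq[X]} (hp : Irreducible p) (k : ℕ) : mult p (p ^ k) = k :=
  multiplicity_pow_self hp.ne_zero hp.not_isUnit k

theorem mult_pow_of_ne {p q : Fq[X]} (hp : p.Monic) (hq : q.Monic)
    (hpi : Irreducible p) (hqi : Irreducible q) (h : p ≠ q) (k : ℕ) : mult p (q ^ k) = 0 :=
  mult_eq_zero fun hd => h (eq_of_monic_irreducible_dvd hp hq hpi hqi (hpi.prime.dvd_of_dvd_pow hd))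

theorem tau_one : tau (1 : Fq[X]) = 1 := by
  have : {d : Fq[X] | d.Monic ∧ d ∣ 1} = {1} := by
    ext d
    simp only [Set.mem_ofPred_eq, Set.mem_singleton_iff]
    constructor
    · rintro ⟨hd, h⟩
      exact hd.eq_one_of_isUnit (isUnit_of_dvd_one h)
    · rintro rfl
      exact ⟨monic_one, dvd_rfl⟩
  rw [tau, this, Set.ncard_singleton]

theorem tau_pow_mul {p g : Fq[X]} (hpm : p.Monic) (hp : Irreducible p)
    (hn : ¬ p ∣ g) (k : ℕ) : tau (p ^ k * g) = (k + 1) * tau g := by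
  have himg : {d : Fq[X] | d.Monic ∧ d ∣ p ^ k * g} =
      (fun z : ℕ × Fq[X] => p ^ z.1 * z.2) ''
        ((Finset.range (k + 1) : Set ℕ) ×ˢ {d : Fq[X] | d.Monic ∧ d ∣ g}) := by
    ext d
    simp only [Set.mem_ofPred_eq, Set.mem_image, Set.mem_prod, Prod.exists, Finset.coe_range,
      Set.mem_Iio]
    constructor
    · rintro ⟨hd, hdvd⟩
      obtain ⟨e, he, hne, hde⟩ := exists_eq_pow_mult_mul hpm hp hd
      have hpe : IsCoprime p e := (hp.coprime_iff_not_dvd).2 hne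
      have hpg : IsCoprime p g := (hp.coprime_iff_not_dvd).2 hn
      refine ⟨mult p d, e, ⟨?_, he, ?_⟩, hde.symm⟩
      · have h1 : p ^ mult p d ∣ p ^ k * g := (Dvd.intro _ hde.symm).trans hdvd
        have h2 : p ^ mult p d ∣ p ^ k := (hpg.pow_left).dvd_of_dvd_mul_right h1
        have := (pow_dvd_pow_iff hp.ne_zero hp.not_isUnit).1 h2
        omega
      · have h1 : e ∣ p ^ k * g := (Dvd.intro_left _ hde.symm).trans hdvd
        exact (hpe.symm.pow_right).dvd_of_dvd_mul_left h1
    · rintro ⟨i, e, ⟨hi, he, heg⟩, rfl⟩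
      exact ⟨(hpm.pow i).mul he, mul_dvd_mul (pow_dvd_pow p (by omega)) heg⟩
  have hinj : Set.InjOn (fun z : ℕ × Fq[X] => p ^ z.1 * z.2)
      ((Finset.range (k + 1) : Set ℕ) ×ˢ {d : Fq[X] | d.Monic ∧ d ∣ g}) := by
    have key : ∀ (i : ℕ) (e : Fq[X]), e.Monic → e ∣ g → mult p (p ^ i * e) = i := by
      intro i e he heg
      rw [mult_mul hp (pow_ne_zero _ hp.ne_zero) he.ne_zero, mult_pow_self hp,
        mult_eq_zero fun h => hn (h.trans heg), add_zero]
    rintro ⟨i, e⟩ ⟨-, he, heg⟩ ⟨j, e'⟩ ⟨-, he', heg'⟩ h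
    have hij : i = j := by
      have := congrArg (mult p) h
      simpa only [key i e he heg, key j e' he' heg'] using this
    subst hij
    have : e = e' := mul_left_cancel₀ (pow_ne_zero i hp.ne_zero) h
    rw [this]
  rw [tau, himg, hinj.ncard_image, Set.ncard_prod, Set.ncard_coe_finset,
    Finset.card_range, tau]

theorem monic_prod_pow {S : Finset Fq[X]} (hS : ∀ p ∈ S, p.Monic ∧ Irreducible p)
    (e : Fq[X] → ℕ) : (∏ p ∈ S, p ^ e p).Monic :=
  monic_prod_of_monic _ _ fun p hp => (hS p hp).1.pow _

theorem mult_prod_pow {S : Finset Fq[X]} (hS : ∀ p ∈ S, p.Monic ∧ Irreducible p)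
    (e : Fq[X] → ℕ) {p : Fq[X]} (hpm : p.Monic) (hp : Irreducible p) :
    (p ∈ S → mult p (∏ q ∈ S, q ^ e q) = e p) ∧ (p ∉ S → mult p (∏ q ∈ S, q ^ e q) = 0) := by
  classical
  induction S using Finset.induction_on with
  | empty =>
    refine ⟨by simp, fun _ => ?_⟩
    rw [Finset.prod_empty]
    exact mult_eq_zero hp.not_dvd_one
  | insert a S ha ih =>
    have hS' : ∀ p ∈ S, p.Monic ∧ Irreducible p := fun q hq => hS q (Finset.mem_insert_of_mem hq)
    obtain ⟨ham, hai⟩ := hS a (Finset.mem_insert_self a S)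
    obtain ⟨ih1, ih2⟩ := ih hS'
    rw [Finset.prod_insert ha, mult_mul hp (pow_ne_zero _ hai.ne_zero)
      (monic_prod_pow hS' e).ne_zero]
    by_cases hpa : p = a
    · subst hpa
      simp [mult_pow_self hp, ih2 ha]
    · rw [mult_pow_of_ne hpm ham hp hai hpa, zero_add]
      simpa [hpa] using ⟨ih1, ih2⟩

theorem tau_prod_pow {S : Finset Fq[X]} (hS : ∀ p ∈ S, p.Monic ∧ Irreducible p)
    (e : Fq[X] → ℕ) : tau (∏ p ∈ S, p ^ e p) = ∏ p ∈ S, (e p + 1) := by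
  classical
  induction S using Finset.induction_on with
  | empty => simp [tau_one]
  | insert a S ha ih =>
    have hS' : ∀ p ∈ S, p.Monic ∧ Irreducible p := fun q hq => hS q (Finset.mem_insert_of_mem hq)
    obtain ⟨ham, hai⟩ := hS a (Finset.mem_insert_self a S)
    rw [Finset.prod_insert ha, Finset.prod_insert ha, ← ih hS']
    refine tau_pow_mul ham hai ?_ _
    rw [← multiplicity_eq_zero]
    exact (mult_prod_pow hS' e ham hai).2 ha

theorem natDegree_prod_pow {S : Finset Fq[X]} (hS : ∀ p ∈ S, p.Monic ∧ Irreducible p)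
    (e : Fq[X] → ℕ) : (∏ p ∈ S, p ^ e p).natDegree = ∑ p ∈ S, e p * p.natDegree := by
  rw [natDegree_prod_of_monic _ _ fun p hp => (hS p hp).1.pow _]
  exact Finset.sum_congr rfl fun p _ => natDegree_pow p _

theorem eq_prod_pow_mult {S : Finset Fq[X]} (hS : ∀ p ∈ S, p.Monic ∧ Irreducible p)
    {f : Fq[X]} (hf : f.Monic) (hfS : ∀ p : Fq[X], p.Monic → Irreducible p → p ∣ f → p ∈ S) :
    f = ∏ p ∈ S, p ^ mult p f := by
  classical
  induction S using Finset.induction_on generalizing f with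
  | empty =>
    by_contra h1
    obtain ⟨p, hpm, hp, hd⟩ := exists_monic_irreducible_dvd hf h1
    exact Finset.notMem_empty p (hfS p hpm hp hd)
  | insert a S ha ih =>
    have hS' : ∀ p ∈ S, p.Monic ∧ Irreducible p := fun q hq => hS q (Finset.mem_insert_of_mem hq)
    obtain ⟨ham, hai⟩ := hS a (Finset.mem_insert_self a S)
    obtain ⟨g, hg, hn, hfg⟩ := exists_eq_pow_mult_mul ham hai hf
    have hgS := ih hS' hg fun p hpm hp hd => by
      have hmem := hfS p hpm hp (hfg ▸ hd.mul_left _)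
      refine Finset.mem_of_mem_insert_of_ne hmem ?_
      rintro rfl
      exact hn hd
    rw [Finset.prod_insert ha]
    have hprod : ∏ p ∈ S, p ^ mult p f = g := by
      conv_rhs => rw [hgS]
      refine Finset.prod_congr rfl fun p hp => ?_
      have hpa : p ≠ a := by
        rintro rfl
        exact ha hp
      obtain ⟨hpm, hpi⟩ := hS' p hp
      rw [hfg, mult_mul hpi (pow_ne_zero _ hai.ne_zero) hg.ne_zero,
        mult_pow_of_ne hpm ham hpi hai hpa, zero_add]
    rw [hprod]
    exact hfg

/-- The monic irreducible divisors of a nonzero polynomial form a finite set. -/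
theorem finite_monic_irreducible_dvd {f : Fq[X]} (hf : f ≠ 0) :
    {p : Fq[X] | p.Monic ∧ Irreducible p ∧ p ∣ f}.Finite := by
  classical
  refine (UniqueFactorizationMonoid.normalizedFactors f).toFinset.finite_toSet.subset ?_
  rintro p ⟨hpm, hp, hd⟩
  rw [Finset.mem_coe, Multiset.mem_toFinset, Polynomial.mem_normalizedFactors_iff hf]
  exact ⟨hp, hpm, hd⟩

theorem eq_of_mult_eq {f g : Fq[X]} (hf : f.Monic) (hg : g.Monic)
    (h : ∀ p : Fq[X], p.Monic → Irreducible p → mult p f = mult p g) : f = g := by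
  have hfin := finite_monic_irreducible_dvd (mul_ne_zero hf.ne_zero hg.ne_zero)
  have hS : ∀ p ∈ hfin.toFinset, p.Monic ∧ Irreducible p := fun p hp =>
    ⟨(hfin.mem_toFinset.1 hp).1, (hfin.mem_toFinset.1 hp).2.1⟩
  calc f = ∏ p ∈ hfin.toFinset, p ^ mult p f := eq_prod_pow_mult hS hf fun p hpm hp hd =>
        hfin.mem_toFinset.2 ⟨hpm, hp, hd.mul_right g⟩
    _ = ∏ p ∈ hfin.toFinset, p ^ mult p g :=
        Finset.prod_congr rfl fun p hp => by rw [h p (hS p hp).1 (hS p hp).2]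
    _ = g := (eq_prod_pow_mult hS hg fun p hpm hp hd =>
        hfin.mem_toFinset.2 ⟨hpm, hp, hd.mul_left f⟩).symm

theorem finite_natDegree_lt [Finite Fq] (N : ℕ) : {p : Fq[X] | p.natDegree < N}.Finite := by
  have : Finite (degreeLT Fq N) := Finite.of_equiv _ (degreeLTEquiv Fq N).symm.toEquiv
  refine (Set.toFinite (degreeLT Fq N : Set Fq[X])).subset fun p hp => ?_
  rw [SetLike.mem_coe, mem_degreeLT]
  exact degree_le_natDegree.trans_lt (by exact_mod_cast hp)

end Factorization

section Maximizers

theorem forall_succ_div_pow_le_iff {a : ℝ} (ha : 1 < a) (k : ℕ) :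
    (∀ j : ℕ, ((j : ℝ) + 1) / a ^ j ≤ ((k : ℝ) + 1) / a ^ k) ↔
      (k : ℝ) * (a - 1) ≤ 1 ∧ 1 ≤ ((k : ℝ) + 1) * (a - 1) := by
  have ha0 : 0 < a := by linarith
  constructor
  · intro h
    constructor
    · cases k with
      | zero => simp
      | succ k =>
        have := h k
        rw [div_le_div_iff₀ (by positivity) (by positivity), pow_succ] at this
        have hp : 0 < a ^ k := by positivity
        push_cast at this ⊢
        have : ((k : ℝ) + 1) * a ≤ (k + 1 + 1) := by
          refine le_of_mul_le_mul_right ?_ hp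
          linarith
        linarith
    · have := h (k + 1)
      rw [div_le_div_iff₀ (by positivity) (by positivity), pow_succ] at this
      have hp : 0 < a ^ k := by positivity
      push_cast at this
      have : (k : ℝ) + 1 + 1 ≤ (k + 1) * a := by
        refine le_of_mul_le_mul_right ?_ hp
        linarith
      linarith
  · rintro ⟨h1, h2⟩ j
    rw [div_le_div_iff₀ (by positivity) (by positivity)]
    rcases le_total k j with hkj | hjk
    · obtain ⟨m, rfl⟩ := Nat.exists_eq_add_of_le hkj
      have hb : 1 + (m : ℝ) * (a - 1) ≤ a ^ m := by
        have := one_add_mul_le_pow (a := a - 1) (by linarith) m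
        simpa using this
      have hm : (0 : ℝ) ≤ m := m.cast_nonneg
      have hk : (0 : ℝ) ≤ k := k.cast_nonneg
      have h3 : ((k + m : ℕ) : ℝ) + 1 ≤ (k + 1) * a ^ m := by
        push_cast
        nlinarith [mul_le_mul_of_nonneg_left hb (by linarith : (0 : ℝ) ≤ k + 1),
          mul_le_mul_of_nonneg_left h2 hm]
      have hp : 0 < a ^ k := by positivity
      calc _ ≤ ((k + 1) * a ^ m) * a ^ k := by gcongr
        _ = _ := by rw [pow_add]; ring
    · obtain ⟨m, rfl⟩ := Nat.exists_eq_add_of_le hjk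
      have h3 : ((j : ℝ) + 1) * a ^ m ≤ ((j + m : ℕ) : ℝ) + 1 := by
        clear h2 hjk
        induction m with
        | zero => simp
        | succ m ih =>
          push_cast at h1 ih ⊢
          have hj := ih (by nlinarith)
          rw [pow_succ]
          nlinarith [mul_le_mul_of_nonneg_right hj ha0.le]
      have hp : 0 < a ^ j := by positivity
      calc _ = (((j : ℝ) + 1) * a ^ m) * a ^ j := by rw [pow_add]; ring
        _ ≤ _ := by gcongr

variable {Fq : Type} [Field Fq]

theorem tau_div_pow_prod_pow {A : ℝ} {S : Finset Fq[X]}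
    (hS : ∀ p ∈ S, p.Monic ∧ Irreducible p) (e : Fq[X] → ℕ) :
    (tau (∏ p ∈ S, p ^ e p) : ℝ) / A ^ (∏ p ∈ S, p ^ e p).natDegree =
      ∏ p ∈ S, ((e p : ℝ) + 1) / (A ^ p.natDegree) ^ e p := by
  rw [tau_prod_pow hS, natDegree_prod_pow hS, Finset.prod_div_distrib, ← Finset.prod_pow_eq_pow_sum]
  push_cast
  congr 1
  exact Finset.prod_congr rfl fun p _ => by rw [← pow_mul, mul_comm]

theorem forall_tau_div_pow_le_iff {A : ℝ} (hA : 1 < A) {h : Fq[X]} (hh : h.Monic) :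
    (∀ f : Fq[X], f.Monic → (tau f : ℝ) / A ^ f.natDegree ≤ (tau h : ℝ) / A ^ h.natDegree) ↔
      ∀ p : Fq[X], p.Monic → Irreducible p → (mult p h : ℝ) * (A ^ p.natDegree - 1) ≤ 1 ∧
        1 ≤ ((mult p h : ℝ) + 1) * (A ^ p.natDegree - 1) := by
  classical
  have hA0 : 0 < A := by linarith
  have hAp : ∀ p : Fq[X], Irreducible p → 1 < A ^ p.natDegree := fun p hp =>
    one_lt_pow₀ hA hp.natDegree_pos.ne'
  constructor
  · intro H p hpm hp
    rw [← forall_succ_div_pow_le_iff (hAp p hp)]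
    intro j
    have hfin := finite_monic_irreducible_dvd hh.ne_zero
    set S := insert p hfin.toFinset with hSdef
    have hS : ∀ q ∈ S, q.Monic ∧ Irreducible q := by
      intro q hq
      rcases Finset.mem_insert.1 hq with rfl | hq
      · exact ⟨hpm, hp⟩
      · exact ⟨(hfin.mem_toFinset.1 hq).1, (hfin.mem_toFinset.1 hq).2.1⟩
    have hhS := eq_prod_pow_mult hS hh fun q hqm hq hd =>
      Finset.mem_insert_of_mem (hfin.mem_toFinset.2 ⟨hqm, hq, hd⟩)
    have hpS : p ∈ S := Finset.mem_insert_self _ _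
    have hle := H (∏ q ∈ S, q ^ (Function.update (fun q => mult q h) p j) q) (monic_prod_pow hS _)
    have hval := tau_div_pow_prod_pow (A := A) hS fun q => mult q h
    rw [← hhS] at hval
    rw [hval, tau_div_pow_prod_pow hS, ← Finset.mul_prod_erase S _ hpS,
      ← Finset.mul_prod_erase S _ hpS, Function.update_self,
      Finset.prod_congr (g := fun q => ((mult q h : ℝ) + 1) / (A ^ q.natDegree) ^ mult q h) rfl
        fun q hq => by rw [Function.update_of_ne (Finset.ne_of_mem_erase hq)]] at hle
    exact le_of_mul_le_mul_right hle (Finset.prod_pos fun q _ => by positivity)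
  · intro H f hf
    have hfin := finite_monic_irreducible_dvd (mul_ne_zero hf.ne_zero hh.ne_zero)
    have hS : ∀ p ∈ hfin.toFinset, p.Monic ∧ Irreducible p := fun p hp =>
      ⟨(hfin.mem_toFinset.1 hp).1, (hfin.mem_toFinset.1 hp).2.1⟩
    have hf' := tau_div_pow_prod_pow (A := A) hS fun q => mult q f
    have hh' := tau_div_pow_prod_pow (A := A) hS fun q => mult q h
    rw [← eq_prod_pow_mult hS hf fun p hpm hp hd =>
      hfin.mem_toFinset.2 ⟨hpm, hp, hd.mul_right h⟩] at hf'
    rw [← eq_prod_pow_mult hS hh fun p hpm hp hd =>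
      hfin.mem_toFinset.2 ⟨hpm, hp, hd.mul_left f⟩] at hh'
    rw [hf', hh']
    refine Finset.prod_le_prod (fun p _ => by positivity) fun p hp => ?_
    obtain ⟨hpm, hpi⟩ := hS p hp
    exact (forall_succ_div_pow_le_iff (hAp p hpi) _).2 (H p hpm hpi) _

theorem le_of_succ_pow_mul_pow_eq {r m d s : ℕ} (hr : 0 < r) (hm : 0 < m) (hd : 0 < d)
    (h : (r + 1) ^ d * m ^ s = (m + 1) ^ s * r ^ d) : s ≤ d := by
  have h1 : r ^ d ∣ m ^ s := by
    have hc : Nat.Coprime (r ^ d) ((r + 1) ^ d) :=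
      Nat.Coprime.pow _ _ (by simp)
    exact hc.dvd_of_dvd_mul_left (h ▸ Dvd.intro_left _ rfl)
  have h2 : m ^ s ∣ r ^ d := by
    have hc : Nat.Coprime (m ^ s) ((m + 1) ^ s) :=
      Nat.Coprime.pow _ _ (by simp)
    exact hc.dvd_of_dvd_mul_left (h ▸ Dvd.intro_left _ rfl)
  have h3 := Nat.dvd_antisymm h1 h2
  by_contra! hlt
  have hmr : m ≤ r := by
    by_contra! hrm
    have h5 := Nat.pow_lt_pow_left hrm hd.ne'
    have h6 := Nat.pow_le_pow_right hm hlt.le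
    omega
  obtain ⟨e, rfl⟩ := Nat.exists_eq_add_of_le hlt.le
  refine h.not_lt ?_
  have h5 : (r + 1) ^ d * m ^ d ≤ (m + 1) ^ d * r ^ d := by
    rw [← mul_pow, ← mul_pow]
    exact Nat.pow_le_pow_left (by nlinarith) d
  have h6 : m ^ e < (m + 1) ^ e := Nat.pow_lt_pow_left (Nat.lt_succ_self m) (by omega)
  calc (r + 1) ^ d * m ^ (d + e) = (r + 1) ^ d * m ^ d * m ^ e := by ring
    _ ≤ (m + 1) ^ d * r ^ d * m ^ e := Nat.mul_le_mul_right _ h5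
    _ < (m + 1) ^ d * r ^ d * (m + 1) ^ e := Nat.mul_lt_mul_of_pos_left h6 (by positivity)
    _ = (m + 1) ^ (d + e) * r ^ d := by ring

theorem eq_of_pow_eq_one_add_inv {A : ℝ} {r m d s : ℕ} (hr : 0 < r) (hm : 0 < m) (hd : 0 < d)
    (hs : 0 < s) (h1 : A ^ s = 1 + 1 / (r : ℝ)) (h2 : A ^ d = 1 + 1 / (m : ℝ)) : d = s := by
  have h : (r + 1) ^ d * m ^ s = (m + 1) ^ s * r ^ d := by
    have hr' : (r : ℝ) ≠ 0 := by positivity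
    have hm' : (m : ℝ) ≠ 0 := by positivity
    have h3 : (1 + 1 / (r : ℝ)) ^ d = (1 + 1 / (m : ℝ)) ^ s := by
      rw [← h1, ← h2, ← pow_mul, ← pow_mul, mul_comm]
    rw [one_add_div hr', one_add_div hm', div_pow, div_pow,
      div_eq_div_iff (by positivity) (by positivity)] at h3
    exact_mod_cast h3
  exact le_antisymm (le_of_succ_pow_mul_pow_eq hm hr hs h.symm)
    (le_of_succ_pow_mul_pow_eq hr hm hd h)

theorem mul_le_one_le_iff_of_eq {r : ℕ} (hr : 0 < r) (k : ℕ) :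
    ((k : ℝ) * (1 + 1 / (r : ℝ) - 1) ≤ 1 ∧ 1 ≤ ((k : ℝ) + 1) * (1 + 1 / (r : ℝ) - 1)) ↔
      k = r ∨ k = r - 1 := by
  have hr' : (0 : ℝ) < r := by positivity
  rw [add_sub_cancel_left, mul_one_div, mul_one_div, div_le_one hr', one_le_div hr']
  norm_cast
  omega

theorem mul_le_one_le_iff_of_ne {b : ℝ} (hb : 0 < b) (k : ℕ)
    (hne : 1 ≠ ((k : ℝ) + 1) * b) :
    ((k : ℝ) * b ≤ 1 ∧ 1 ≤ ((k : ℝ) + 1) * b) ↔ k = ⌊1 / b⌋₊ := by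
  rw [eq_comm, Nat.floor_eq_iff (by positivity), le_div_iff₀ hb, div_lt_iff₀ hb]
  exact and_congr_right fun _ => ⟨fun h => h.lt_of_ne hne, le_of_lt⟩

theorem ncard_monic_mult_eq [Finite Fq] {s r N : ℕ} (hr : 0 < r) {φ : ℕ → ℕ}
    (hφ : ∀ d, N ≤ d → φ d = 0) :
    {h : Fq[X] | h.Monic ∧
      (∀ p : Fq[X], p.Monic → Irreducible p → p.natDegree ≠ s → mult p h = φ p.natDegree) ∧
      (∀ p : Fq[X], p.Monic → Irreducible p → p.natDegree = s →
        mult p h = r ∨ mult p h = r - 1)}.ncard =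
      2 ^ {p : Fq[X] | p.Monic ∧ Irreducible p ∧ p.natDegree = s}.ncard := by
  classical
  set P := {p : Fq[X] | p.Monic ∧ Irreducible p ∧ p.natDegree = s} with hP
  have hfinP : P.Finite := (finite_natDegree_lt (s + 1)).subset fun p hp =>
    Nat.lt_succ_of_le hp.2.2.le
  rw [← Set.ncard_powerset P hfinP]
  refine Set.ncard_congr (fun h _ => {p | p ∈ P ∧ mult p h = r}) (fun h _ p hp => hp.1) ?_ ?_
  · rintro f g ⟨hf, hf1, hf2⟩ ⟨hg, hg1, hg2⟩ heq
    refine eq_of_mult_eq hf hg fun p hpm hp => ?_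
    by_cases hps : p.natDegree = s
    · have hpP : p ∈ P := ⟨hpm, hp, hps⟩
      have hiff : mult p f = r ↔ mult p g = r := by
        have := Set.ext_iff.1 heq p
        simpa only [Set.mem_ofPred_eq, hpP, true_and] using this
      have := hf2 p hpm hp hps
      have := hg2 p hpm hp hps
      omega
    · rw [hf1 p hpm hp hps, hg1 p hpm hp hps]
  · intro T hT
    have hfin : {p : Fq[X] | p.Monic ∧ Irreducible p ∧ p.natDegree < max N (s + 1)}.Finite :=
      (finite_natDegree_lt (max N (s + 1))).subset fun p hp => hp.2.2
    have hS : ∀ p ∈ hfin.toFinset, p.Monic ∧ Irreducible p := fun p hp =>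
      ⟨(hfin.mem_toFinset.1 hp).1, (hfin.mem_toFinset.1 hp).2.1⟩
    let e : Fq[X] → ℕ := fun p =>
      if p.natDegree = s then if p ∈ T then r else r - 1 else φ p.natDegree
    have hmult : ∀ p : Fq[X], p.Monic → Irreducible p →
        mult p (∏ p ∈ hfin.toFinset, p ^ e p) = e p := by
      intro p hpm hp
      by_cases hpS : p ∈ hfin.toFinset
      · exact (mult_prod_pow hS e hpm hp).1 hpS
      · rw [(mult_prod_pow hS e hpm hp).2 hpS]
        have hdeg : max N (s + 1) ≤ p.natDegree := by
          by_contra! hlt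
          exact hpS (hfin.mem_toFinset.2 ⟨hpm, hp, hlt⟩)
        have hne : p.natDegree ≠ s := by omega
        simp only [e, if_neg hne]
        exact (hφ _ (by omega)).symm
    refine ⟨∏ p ∈ hfin.toFinset, p ^ e p, ⟨monic_prod_pow hS e, ?_, ?_⟩, ?_⟩
    · intro p hpm hp hps
      rw [hmult p hpm hp]
      exact if_neg hps
    · intro p hpm hp hps
      rw [hmult p hpm hp]
      simp only [e, if_pos hps]
      split_ifs
      · exact Or.inl rfl
      · exact Or.inr rfl
    · ext p
      constructor
      · rintro ⟨⟨hpm, hp, hps⟩, hpr⟩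
        rw [hmult p hpm hp] at hpr
        by_contra hpT
        simp only [e, if_pos hps, if_neg hpT] at hpr
        omega
      · intro hpT
        obtain ⟨hpm, hp, hps⟩ := hT hpT
        refine ⟨⟨hpm, hp, hps⟩, ?_⟩
        rw [hmult p hpm hp]
        simp only [e, if_pos hps, if_pos hpT]

end Maximizers

/-- For `x = s log q / log(1 + 1/r) ∈ S`, a monic polynomial maximizes
`f ↦ τ(f) q^{-deg f / x}` iff its multiplicity at each monic irreducible `p` is
`⌊1/(q^{deg p / x} - 1)⌋` when `deg p ≠ s`, and `r` or `r - 1` when `deg p = s`;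
consequently there are exactly `2^{π(s)}` maximizers. -/
theorem maximizer_multiplicities_of_mem_S {Fq : Type} [Field Fq] [Fintype Fq]
    (s r : ℕ) (hs : 0 < s) (hr : 0 < r) (x : ℝ)
    (hx : x = (s : ℝ) * Real.log (Fintype.card Fq) / Real.log (1 + 1 / (r : ℝ))) :
    (∀ h : Fq[X], h.Monic →
      ((∀ f : Fq[X], f.Monic →
        (tau f : ℝ) * (Fintype.card Fq : ℝ) ^ (-(f.natDegree : ℝ) / x) ≤
        (tau h : ℝ) * (Fintype.card Fq : ℝ) ^ (-(h.natDegree : ℝ) / x)) ↔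
      ((∀ p : Fq[X], p.Monic → Irreducible p → p.natDegree ≠ s →
          mult p h = ⌊1 / ((Fintype.card Fq : ℝ) ^ ((p.natDegree : ℝ) / x) - 1)⌋₊) ∧
        (∀ p : Fq[X], p.Monic → Irreducible p → p.natDegree = s →
          mult p h = r ∨ mult p h = r - 1)))) ∧
    {h : Fq[X] | h.Monic ∧ ∀ f : Fq[X], f.Monic →
        (tau f : ℝ) * (Fintype.card Fq : ℝ) ^ (-(f.natDegree : ℝ) / x) ≤
        (tau h : ℝ) * (Fintype.card Fq : ℝ) ^ (-(h.natDegree : ℝ) / x)}.ncard =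
      2 ^ {p : Fq[X] | p.Monic ∧ Irreducible p ∧ p.natDegree = s}.ncard := by
  set q : ℝ := (Fintype.card Fq : ℝ) with hq
  have hq1 : 1 < q := by
    rw [hq]
    exact_mod_cast Fintype.one_lt_card
  have hq0 : 0 < q := by linarith
  have hs' : (0 : ℝ) < s := by exact_mod_cast hs
  have hr' : (0 : ℝ) < 1 / (r : ℝ) := by positivity
  have hlogq : 0 < Real.log q := Real.log_pos hq1
  have hlogr : 0 < Real.log (1 + 1 / (r : ℝ)) := Real.log_pos (by linarith)
  have hx0 : 0 < x := by
    rw [hx]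
    positivity
  obtain ⟨A, hA⟩ : ∃ A : ℝ, A = q ^ (1 / x) := ⟨_, rfl⟩
  have hA1 : 1 < A := hA ▸ Real.one_lt_rpow hq1 (by positivity)
  have hpow : ∀ n : ℕ, q ^ ((n : ℝ) / x) = A ^ n := by
    intro n
    rw [hA, ← Real.rpow_natCast, ← Real.rpow_mul hq0.le, one_div_mul_eq_div]
  have hneg : ∀ (c : ℝ) (n : ℕ), c * q ^ (-(n : ℝ) / x) = c / A ^ n := by
    intro c n
    rw [neg_div, Real.rpow_neg hq0.le, hpow, div_eq_mul_inv]
  have hAs : A ^ s = 1 + 1 / (r : ℝ) := by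
    rw [← hpow, Real.rpow_def_of_pos hq0, hx,
      show Real.log q * (s / (s * Real.log q / Real.log (1 + 1 / (r : ℝ)))) =
        Real.log (1 + 1 / (r : ℝ)) by field_simp]
    exact Real.exp_log (by linarith)
  simp only [hneg, hpow]
  have hmain : ∀ h : Fq[X], h.Monic →
      ((∀ f : Fq[X], f.Monic →
        (tau f : ℝ) / A ^ f.natDegree ≤ (tau h : ℝ) / A ^ h.natDegree) ↔
      ((∀ p : Fq[X], p.Monic → Irreducible p → p.natDegree ≠ s →
          mult p h = ⌊1 / (A ^ p.natDegree - 1)⌋₊) ∧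
        (∀ p : Fq[X], p.Monic → Irreducible p → p.natDegree = s →
          mult p h = r ∨ mult p h = r - 1))) := by
    intro h hh
    rw [forall_tau_div_pow_le_iff hA1 hh]
    have heq : ∀ p : Fq[X], p.natDegree = s → (((mult p h : ℝ) * (A ^ p.natDegree - 1) ≤ 1 ∧
        1 ≤ ((mult p h : ℝ) + 1) * (A ^ p.natDegree - 1)) ↔
          (mult p h = r ∨ mult p h = r - 1)) := by
      intro p hps
      rw [hps, hAs]
      exact mul_le_one_le_iff_of_eq hr _
    have hne : ∀ p : Fq[X], Irreducible p → p.natDegree ≠ s →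
        (((mult p h : ℝ) * (A ^ p.natDegree - 1) ≤ 1 ∧
          1 ≤ ((mult p h : ℝ) + 1) * (A ^ p.natDegree - 1)) ↔
          mult p h = ⌊1 / (A ^ p.natDegree - 1)⌋₊) := by
      intro p hp hps
      refine mul_le_one_le_iff_of_ne
        (sub_pos.2 (one_lt_pow₀ hA1 hp.natDegree_pos.ne')) _ fun h1 => hps ?_
      refine eq_of_pow_eq_one_add_inv hr (Nat.succ_pos (mult p h)) hp.natDegree_pos hs hAs ?_
      have hk : (0 : ℝ) < (mult p h : ℝ) + 1 := by positivity
      have h2 := eq_div_of_mul_eq hk.ne' ((mul_comm _ _).trans h1.symm)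
      push_cast
      linarith
    constructor
    · exact fun H => ⟨fun p hpm hp hps => (hne p hp hps).1 (H p hpm hp),
        fun p hpm hp hps => (heq p hps).1 (H p hpm hp)⟩
    · rintro ⟨H1, H2⟩ p hpm hp
      by_cases hps : p.natDegree = s
      · exact (heq p hps).2 (H2 p hpm hp hps)
      · exact (hne p hp hps).2 (H1 p hpm hp hps)
  refine ⟨hmain, ?_⟩
  obtain ⟨N, hN⟩ := pow_unbounded_of_one_lt 2 hA1
  rw [← ncard_monic_mult_eq (Fq := Fq) (N := N) hr (φ := fun d => ⌊1 / (A ^ d - 1)⌋₊)]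
  · congr 1
    ext h
    exact and_congr_right (hmain h)
  · intro d hd
    have hle : A ^ N ≤ A ^ d := pow_le_pow_right₀ hA1.le hd
    rw [Nat.floor_eq_zero, div_lt_one (by linarith)]
    linarith
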